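/- arXiv:2104.12956 — 2 statements merged into one kernel-verified Lean document; each statement's English description precedes it below -/
import Mathlib

section
/- Let N ≥ 1, let f : ℝ^N → ℂ be a Schwartz function, let θ = (θ_{ij}) be an N×N complex matrix, and let β ∈ ℂ. If for all x ∈ ℝ^N one has ∑_{i,j=1}^N θ_{ji} x_i (∂f/∂x_j)(x) + β f(x) = 0, then the Fourier transform f̂ = 𝓕f (which is again Schwartz, hence differentiable) satisfies ∑_{i,j=1}^N θ_{ji} ξ_j (∂f̂/∂ξ_i)(ξ) + (Tr(θ) − β) f̂(ξ) = 0 for all ξ ∈ ℝ^N. -/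
open SchwartzMap Real

open LineDeriv FourierTransform

section FourierEuler

variable {V E : Type*} [NormedAddCommGroup V] [InnerProductSpace ℝ V]
  [NormedAddCommGroup E] [NormedSpace ℂ E]

theorem hasTemperateGrowth_inner_left (m : V) :
    (fun x : V ↦ inner ℝ x m).HasTemperateGrowth :=
  ((innerSL ℝ).flip m).hasTemperateGrowth

/-- Leibniz rule for the product of a Schwartz function with a linear form. -/
theorem lineDerivOp_smulLeftCLM_inner (f : 𝓢(V, E)) (m n : V) :
    ∂_{m} (smulLeftCLM E (fun x ↦ inner ℝ x n) f) =
      inner ℝ m n • f + smulLeftCLM E (fun x ↦ inner ℝ x n) (∂_{m} f) := by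
  ext x
  have hg : HasFDerivAt (fun y : V ↦ inner ℝ y n) ((innerSL ℝ).flip n) x :=
    ((innerSL ℝ).flip n).hasFDerivAt
  rw [lineDerivOp_apply_eq_fderiv, smulLeftCLM_apply (hasTemperateGrowth_inner_left n),
    (hg.fun_smul (f.hasFDerivAt x)).fderiv]
  simp [hasTemperateGrowth_inner_left n, lineDerivOp_apply_eq_fderiv, innerSL_apply_apply ℝ,
    add_comm, real_inner_comm n m]

variable [FiniteDimensional ℝ V] [MeasurableSpace V] [BorelSpace V]

/-- The Fourier transform of `⟪x, m⟫ ∂_n f` is `-∂_m (⟪ξ, n⟫ 𝓕 f)`. -/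
theorem fourier_smulLeftCLM_inner_lineDerivOp (f : 𝓢(V, E)) (m n : V) :
    𝓕 (smulLeftCLM E (fun x ↦ inner ℝ x m) (∂_{n} f)) =
      -(inner ℝ m n • 𝓕 f + smulLeftCLM E (fun x ↦ inner ℝ x n) (∂_{m} (𝓕 f))) := by
  have key := lineDerivOp_fourier_eq (∂_{n} f) m
  rw [fourier_lineDerivOp_eq, lineDerivOp_smul, lineDerivOp_smulLeftCLM_inner,
    FourierTransform.fourier_smul, neg_smul, ← smul_neg] at key
  rw [smul_right_injective _ Complex.two_pi_I_ne_zero key, neg_neg]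

end FourierEuler

/-- If a Schwartz function `f` on `ℝ^N` satisfies
`∑_{i,j} θ_{ji} x_i ∂f/∂x_j + β f = 0`, then its Fourier transform `𝓕 f` satisfies
`∑_{i,j} θ_{ji} ξ_j ∂(𝓕 f)/∂ξ_i + (Tr θ - β) (𝓕 f) = 0`. -/
theorem statement0 (N : ℕ) (hN : 1 ≤ N)
    (f : SchwartzMap (EuclideanSpace ℝ (Fin N)) ℂ)
    (θ : Matrix (Fin N) (Fin N) ℂ) (β : ℂ)
    (h : ∀ x : EuclideanSpace ℝ (Fin N),
      (∑ i, ∑ j, θ j i * (x i : ℂ) *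
          fderiv ℝ (⇑f) x (EuclideanSpace.single j 1)) + β * f x = 0) :
    ∀ ξ : EuclideanSpace ℝ (Fin N),
      (∑ i, ∑ j, θ j i * (ξ j : ℂ) *
          fderiv ℝ (⇑(fourierTransformCLM ℂ f)) ξ (EuclideanSpace.single i 1)) +
        (Matrix.trace θ - β) * (fourierTransformCLM ℂ f ξ) = 0 := by
  intro ξ
  let e (i : Fin N) : EuclideanSpace ℝ (Fin N) := EuclideanSpace.single i 1
  have he (x : EuclideanSpace ℝ (Fin N)) (i : Fin N) : inner ℝ x (e i) = x i := by
    simp [e, EuclideanSpace.inner_single_right]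
  have hmul (g : 𝓢(EuclideanSpace ℝ (Fin N), ℂ)) (x : EuclideanSpace ℝ (Fin N)) (i : Fin N) :
      smulLeftCLM ℂ (fun y ↦ inner ℝ y (e i)) g x = (x i : ℂ) * g x := by
    rw [smulLeftCLM_apply_apply (hasTemperateGrowth_inner_left _), he, Complex.real_smul]
  have hsum : (∑ i, ∑ j, θ j i • smulLeftCLM ℂ (fun x ↦ inner ℝ x (e i)) (∂_{e j} f)) + β • f
      = 0 := by
    ext x
    simpa only [add_apply, sum_apply, smul_apply, zero_apply, smul_eq_mul, hmul,
      lineDerivOp_apply_eq_fderiv, mul_assoc, e] using h x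
  have hF := congrArg (fun g ↦ fourierTransformCLM ℂ g ξ) hsum
  simp only [map_add, map_sum, map_smul, map_zero, fourierTransformCLM_apply,
    fourier_smulLeftCLM_inner_lineDerivOp] at hF
  simp only [add_apply, sum_apply, smul_apply, neg_apply, zero_apply, smul_eq_mul,
    Complex.real_smul, hmul, lineDerivOp_apply_eq_fderiv,
    mul_neg, mul_add, Finset.sum_add_distrib, Finset.sum_neg_distrib] at hF
  simp only [he] at hF
  have htr : ∑ i, ∑ j, θ j i * ((e i j : ℂ) * 𝓕 f ξ) = θ.trace * 𝓕 f ξ := by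
    simp [e, Matrix.trace, Finset.sum_mul, apply_ite Complex.ofReal]
  simp only [fourierTransformCLM_apply, mul_assoc]
  linear_combination -htr - hF
end

section
/- Let k be a field and let (w_{ij}) be an n×N matrix with integer entries. Let φ : k[x_1,…,x_N] → k[ℤ^n] be the k-algebra homomorphism from the polynomial ring in N variables to the group algebra of ℤ^n over k (the ring of Laurent polynomials in t_1,…,t_n) determined by φ(x_j) = t^{w_j} = ∏_{i=1}^n t_i^{w_{ij}}, i.e. φ(x_j) is the group-algebra basis element indexed by the j-th column w_j ∈ ℤ^n. Then the kernel of φ equals the ideal of k[x_1,…,x_N] generated by the binomials x^{a⁺} − x^{a⁻} = ∏_{j : a_j > 0} x_j^{a_j} − ∏_{j : a_j < 0} x_j^{−a_j}, where a = (a_1,…,a_N) ranges over all elements of ℤ^N with ∑_{j=1}^N a_j w_j = 0. -/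
namespace MvPolynomial

/-- If a linear map sends monomials to basis elements of a monoid algebra, then its kernel lies in
every ideal containing all differences of monomials with the same image. -/
theorem mem_ideal_of_map_eq_zero {R σ M : Type*} [CommRing R]
    (f : MvPolynomial σ R →ₗ[R] AddMonoidAlgebra R M) (d : (σ →₀ ℕ) → M)
    (hf : ∀ u, f (monomial u 1) = AddMonoidAlgebra.single (d u) 1)
    (I : Ideal (MvPolynomial σ R))
    (hI : ∀ u v, d u = d v → monomial u (1 : R) - monomial v 1 ∈ I)
    {p : MvPolynomial σ R} (hp : f p = 0) : p ∈ I := by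
  let q : MvPolynomial σ R →ₗ[R] MvPolynomial σ R ⧸ I := (Ideal.Quotient.mkₐ R I).toLinearMap
  let g : AddMonoidAlgebra R M →ₗ[R] MvPolynomial σ R ⧸ I :=
    (AddMonoidAlgebra.basis M R).constr R fun m => q (monomial (Function.invFun d m) 1)
  have hg : g ∘ₗ f = q := by
    refine (basisMonomials σ R).ext fun u => ?_
    have hu : g (AddMonoidAlgebra.single (d u) 1) = q (monomial (Function.invFun d (d u)) 1) := by
      rw [← AddMonoidAlgebra.basis_apply]
      exact Module.Basis.constr_basis ..
    rw [coe_basisMonomials, LinearMap.comp_apply, hf, hu]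
    exact Ideal.Quotient.eq.2 (hI _ _ (Function.invFun_eq ⟨u, rfl⟩))
  refine Ideal.Quotient.eq_zero_iff_mem.1 ?_
  change q p = 0
  rw [← hg, LinearMap.comp_apply, hp, map_zero]

variable {R σ ι : Type*} [CommRing R] [Fintype σ]

theorem prod_filter_X_pow_toNat (a : σ → ℤ) :
    ∏ j ∈ Finset.univ.filter (fun j => 0 < a j), (X j : MvPolynomial σ R) ^ (a j).toNat =
      ∏ j, X j ^ (a j).toNat := by
  refine Finset.prod_filter_of_ne fun j _ hj => ?_
  by_contra h
  exact hj (by rw [Int.toNat_of_nonpos (not_lt.1 h), pow_zero])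

theorem aeval_single_prod_X_pow (w : Matrix ι σ ℤ) (u : σ → ℕ) :
    aeval (fun j => AddMonoidAlgebra.single (fun i => w i j) (1 : R))
        (∏ j, (X j : MvPolynomial σ R) ^ u j) =
      AddMonoidAlgebra.single (fun i => ∑ j, (u j : ℤ) * w i j) (1 : R) := by
  simp only [map_prod, map_pow, aeval_X, AddMonoidAlgebra.single_pow, one_pow,
    AddMonoidAlgebra.prod_single, Finset.prod_const_one]
  congr 1
  ext i
  simp

theorem prod_X_pow_eq_monomial' (u : σ →₀ ℕ) :
    ∏ j, (X j : MvPolynomial σ R) ^ u j = monomial u 1 := by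
  rw [← prod_X_pow_eq_monomial]
  exact (Finset.prod_subset (Finset.subset_univ _) fun j _ hj => by
    rw [Finsupp.notMem_support_iff.1 hj, pow_zero]).symm

end MvPolynomial

/-- The kernel of the `k`-algebra homomorphism `k[x_1,…,x_N] → k[ℤ^n]`, `x_j ↦ t^{w_j}`,
is the toric ideal generated by the binomials
`∏_{a_j>0} x_j^{a_j} - ∏_{a_j<0} x_j^{-a_j}` for integer vectors `a` with `∑_j a_j w_j = 0`. -/
theorem statement5 (k : Type*) [Field k] (n N : ℕ) (w : Matrix (Fin n) (Fin N) ℤ) :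
    RingHom.ker (MvPolynomial.aeval
        (fun j : Fin N => AddMonoidAlgebra.single (fun i => w i j) (1 : k)) :
        MvPolynomial (Fin N) k →ₐ[k] AddMonoidAlgebra k (Fin n → ℤ)) =
      Ideal.span {p : MvPolynomial (Fin N) k | ∃ a : Fin N → ℤ,
        (∀ i, ∑ j, a j * w i j = 0) ∧
        p = ∏ j ∈ Finset.univ.filter (fun j => 0 < a j),
              (MvPolynomial.X j) ^ (a j).toNat -
            ∏ j ∈ Finset.univ.filter (fun j => a j < 0),
              (MvPolynomial.X j) ^ (-a j).toNat} := by
  have neg_part (a : Fin N → ℤ) :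
      ∏ j ∈ Finset.univ.filter (fun j => a j < 0),
        (MvPolynomial.X j : MvPolynomial (Fin N) k) ^ (-a j).toNat =
      ∏ j, MvPolynomial.X j ^ (-a j).toNat := by
    simpa using MvPolynomial.prod_filter_X_pow_toNat (R := k) (-a)
  simp only [neg_part, MvPolynomial.prod_filter_X_pow_toNat]
  refine le_antisymm (fun p hp => ?_) (Ideal.span_le.2 ?_)
  · refine MvPolynomial.mem_ideal_of_map_eq_zero (AlgHom.toLinearMap (MvPolynomial.aeval
        (fun j : Fin N => AddMonoidAlgebra.single (fun i => w i j) (1 : k))))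
      (fun u i => ∑ j, (u j : ℤ) * w i j) (fun u => ?_) _ (fun u v huv => ?_) hp
    · rw [← MvPolynomial.prod_X_pow_eq_monomial', AlgHom.toLinearMap_apply,
        MvPolynomial.aeval_single_prod_X_pow]
    · -- `x^u - x^v` is the multiple by `x^(min u v)` of the binomial attached to `u - v`.
      have hmul : MvPolynomial.monomial u (1 : k) - MvPolynomial.monomial v 1 =
          (∏ j, MvPolynomial.X j ^ min (u j) (v j)) *
            (∏ j, MvPolynomial.X j ^ ((u j : ℤ) - v j).toNat -
              ∏ j, MvPolynomial.X j ^ (-((u j : ℤ) - v j)).toNat) := by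
        simp only [mul_sub, ← Finset.prod_mul_distrib, ← pow_add,
          ← MvPolynomial.prod_X_pow_eq_monomial']
        congr! with j _ j _ <;> omega
      rw [hmul]
      refine Ideal.mul_mem_left _ _ (Ideal.subset_span ⟨fun j => (u j : ℤ) - v j, fun i => ?_, rfl⟩)
      simp only [sub_mul, Finset.sum_sub_distrib]
      exact sub_eq_zero.2 (congrFun huv i)
  · rintro _ ⟨a, ha, rfl⟩
    rw [SetLike.mem_coe, RingHom.mem_ker, map_sub, MvPolynomial.aeval_single_prod_X_pow,
      MvPolynomial.aeval_single_prod_X_pow, sub_eq_zero]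
    congr 1
    ext i
    rw [← sub_eq_zero, ← Finset.sum_sub_distrib, ← ha i]
    refine Finset.sum_congr rfl fun j _ => ?_
    rw [← sub_mul, Int.toNat_sub_toNat_neg]
end
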